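/- There exist a constant c > 0 and a threshold λ₀ > 1, both depending only on g and M, such that for every real λ ≥ λ₀ the following holds ℙ-almost surely: there exists N such that for every integer n ≥ N one has R_n(A) ≥ c · λ^{2g+2} log n, where R_n(A) denotes the number of sets ω ∈ R_n with ω ⊆ A. -/

import Mathlib

noncomputable section

open Real MeasureTheory ProbabilityTheory

def IsSidonZ {M : ℕ} (S : Set (ZMod M)) : Prop :=
  ∀ a ∈ S, ∀ b ∈ S, ∀ c ∈ S, ∀ d ∈ S, a + b = c + d → ({a, b} : Set (ZMod M)) = {c, d}

def Covers3 {M : ℕ} (S : Set (ZMod M)) : Prop :=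
  ∀ z : ZMod M, ∃ s₁ ∈ S, ∃ s₂ ∈ S, ∃ s₃ ∈ S,
    s₁ ≠ s₂ ∧ s₁ ≠ s₃ ∧ s₂ ≠ s₃ ∧ z = s₁ + s₂ + s₃

def alph (g : ℕ) : ℝ := ((g : ℝ) + 1) / (2 * (g : ℝ) + 1)

def glam (g : ℕ) (lam : ℝ) (n : ℕ) : ℝ :=
  lam ^ ((2 * (g : ℝ) + 5) / (1 - alph g)) * (n : ℝ) ^ ((1 : ℝ) / (g : ℝ)) *
    Real.log n ^ ((1 : ℝ) / (1 - alph g))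

def GoodS (M : ℕ) (CM : Set (ZMod M)) (s : ℕ → Fin 3 → ZMod M) : Prop :=
  ∀ n : ℕ, (∀ i, s n i ∈ CM) ∧ s n 0 ≠ s n 1 ∧ s n 0 ≠ s n 2 ∧ s n 1 ≠ s n 2 ∧
    s n 0 + s n 1 + s n 2 = (n : ZMod M)

def Rtrip (g M : ℕ) (lam : ℝ) (s : ℕ → Fin 3 → ZMod M) (n x₁ x₂ x₃ : ℕ) : Prop :=
  0 < x₁ ∧ 0 < x₂ ∧ 0 < x₃ ∧ x₁ + x₂ + x₃ = n ∧
  glam g lam n / 2 ≤ (x₁ : ℝ) ∧ (x₁ : ℝ) ≤ glam g lam n ∧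
  (n : ℝ) / 4 ≤ (x₂ : ℝ) ∧ x₂ ≤ n ∧ (n : ℝ) / 4 ≤ (x₃ : ℝ) ∧ x₃ ≤ n ∧
  (x₁ : ZMod M) = s n 0 ∧ (x₂ : ZMod M) = s n 1 ∧ (x₃ : ZMod M) = s n 2

def Rn (g M : ℕ) (lam : ℝ) (s : ℕ → Fin 3 → ZMod M) (n : ℕ) : Set (Finset ℕ) :=
  {ω | ∃ x₁ x₂ x₃ : ℕ, ω = {x₁, x₂, x₃} ∧ Rtrip g M lam s n x₁ x₂ x₃}

def imgF {m : ℕ} (x : Fin m → ℕ) : Finset ℕ := Finset.image x Finset.univ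

def firstThree (g : ℕ) (x : Fin (2 * g + 4) → ℕ) : Finset ℕ :=
  {x ⟨0, by omega⟩, x ⟨1, by omega⟩, x ⟨2, by omega⟩}

def pairOf (g : ℕ) (x : Fin (2 * g + 4) → ℕ) (j : ℕ) : Finset ℕ :=
  if j = 0 then {x ⟨0, by omega⟩, x ⟨3, by omega⟩}
  else if h : j ≤ g then {x ⟨2 * j + 2, by omega⟩, x ⟨2 * j + 3, by omega⟩}
  else ∅

def Tn (g M : ℕ) (lam : ℝ) (s : ℕ → Fin 3 → ZMod M) (n : ℕ) :
    Set (Fin (2 * g + 4) → ℕ) :=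
  {x | (∀ i, 0 < x i) ∧
    firstThree g x ∈ Rn g M lam s n ∧
    (∀ j : ℕ, 2 ≤ j → ∀ _ : j ≤ g + 1,
      x ⟨0, by omega⟩ + x ⟨3, by omega⟩ = x ⟨2 * j, by omega⟩ + x ⟨2 * j + 1, by omega⟩) ∧
    (∀ i : Fin (2 * g + 4), 3 ≤ (i : ℕ) → x i ≤ x ⟨0, by omega⟩) ∧
    (∀ k : ℕ, 2 ≤ k → ∀ _ : k ≤ g + 1,
      (x ⟨2 * k, by omega⟩ : ZMod M) = (x ⟨0, by omega⟩ : ZMod M) ∧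
      (x ⟨2 * k + 1, by omega⟩ : ZMod M) = (x ⟨3, by omega⟩ : ZMod M)) ∧
    (∀ j k : ℕ, j ≤ g → k ≤ g → j ≠ k → pairOf g x j ≠ pairOf g x k)}

def TnInd (g M : ℕ) (lam : ℝ) (s : ℕ → Fin 3 → ZMod M) (n : ℕ) :
    Set (Fin (2 * g + 4) → ℕ) :=
  {x ∈ Tn g M lam s n | Function.Injective x}

def TnDep (g M : ℕ) (lam : ℝ) (s : ℕ → Fin 3 → ZMod M) (n : ℕ) :
    Set (Fin (2 * g + 4) → ℕ) :=
  {x ∈ Tn g M lam s n | ¬ Function.Injective x}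

def Vr (g : ℕ) (r₁ : ℕ) : Set (Fin (2 * g + 1) → ℕ) :=
  {v | (∀ i, 0 < v i) ∧
    (∀ t : ℕ, ∀ _ : t < g,
      r₁ + v ⟨0, by omega⟩ = v ⟨2 * t + 1, by omega⟩ + v ⟨2 * t + 2, by omega⟩) ∧
    (∀ i, v i ≤ r₁) ∧ Function.Injective v ∧ (∀ i, v i ≠ r₁)}

def Tcal (X r : Finset ℕ) (k : ℕ) (eps : ℕ → ℤ) : Set (ℕ → ℕ) :=
  {y | (∀ j < k, y j ∈ X ∪ r) ∧ (∀ j, k ≤ j → y j = 0) ∧ (∃ j < k, y j ∈ X) ∧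
    (∀ i < k, ∀ j < k, y i = y j → eps i = eps j)}

def Fval (k : ℕ) (eps : ℕ → ℤ) (y : ℕ → ℕ) : ℤ :=
  ∑ j ∈ Finset.range k, eps j * (y j : ℤ)

def Ccal (U X r : Finset ℕ) : Set (Finset ℕ) :=
  {w | w.card = 4 ∧ w ⊆ U ∧ (∃ a ∈ w, a ∈ X ∧ a ∉ r) ∧
    ∃ y₁ y₂ y₃ y₄ : ℕ, w = {y₁, y₂, y₃, y₄} ∧ y₁ + y₂ = y₃ + y₄ ∧
      ({y₁, y₂} : Finset ℕ) ≠ {y₃, y₄}}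

def CcalR (g M : ℕ) (lam : ℝ) (s : ℕ → Fin 3 → ZMod M) (n : ℕ) (X r : Finset ℕ) :
    Set (Finset ℕ) :=
  {w | w ∈ Rn g M lam s n ∧ w ⊆ X ∪ r ∧ ∃ a ∈ w, a ∈ X ∧ a ∉ r}

def Sx (g : ℕ) (x : Fin (2 * g + 4) → ℕ) : Set (Finset ℕ) :=
  {w | ∃ l : ℕ, ∃ _ : 3 ≤ l, ∃ _ : l ≤ g + 2,
      w = ({x ⟨0, by omega⟩, x ⟨3, by omega⟩,
            x ⟨2 * l - 2, by omega⟩, x ⟨2 * l - 1, by omega⟩} : Finset ℕ)} ∪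
  {w | ∃ l j : ℕ, ∃ _ : 3 ≤ l, ∃ _ : l < j, ∃ _ : j ≤ g + 2,
      w = ({x ⟨2 * j - 2, by omega⟩, x ⟨2 * j - 1, by omega⟩,
            x ⟨2 * l - 2, by omega⟩, x ⟨2 * l - 1, by omega⟩} : Finset ℕ)}

def SxV (g : ℕ) (r₁ : ℕ) (v : Fin (2 * g + 1) → ℕ) : Set (Finset ℕ) :=
  {w | ∃ l : ℕ, ∃ _ : 3 ≤ l, ∃ _ : l ≤ g + 2,
      w = ({r₁, v ⟨0, by omega⟩, v ⟨2 * l - 5, by omega⟩, v ⟨2 * l - 4, by omega⟩} : Finset ℕ)} ∪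
  {w | ∃ l j : ℕ, ∃ _ : 3 ≤ l, ∃ _ : l < j, ∃ _ : j ≤ g + 2,
      w = ({v ⟨2 * j - 5, by omega⟩, v ⟨2 * j - 4, by omega⟩,
            v ⟨2 * l - 5, by omega⟩, v ⟨2 * l - 4, by omega⟩} : Finset ℕ)}

def tailSet (g : ℕ) (x : Fin (2 * g + 4) → ℕ) : Finset ℕ :=
  Finset.image (fun i : Fin (2 * g + 1) => x ⟨(i : ℕ) + 3, by have := i.isLt; omega⟩)
    Finset.univ

section RandomSubset

open Classical in
/-- The trace of the set `B` on the finite set `F`. -/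
def traceOn (F : Finset ℕ) (B : Set ℕ) : Finset ℕ := {x ∈ F | x ∈ B}

lemma mem_traceOn {F : Finset ℕ} {B : Set ℕ} {x : ℕ} : x ∈ traceOn F B ↔ x ∈ F ∧ x ∈ B := by
  simp [traceOn]

lemma traceOn_subset (F : Finset ℕ) (B : Set ℕ) : traceOn F B ⊆ F := by
  simp [traceOn]

lemma card_traceOn_eq_sum_indicator {Ω : Type*} {A : Ω → Set ℕ} (N : Finset ℕ) (ω : Ω) :
    ((traceOn N (A ω)).card : ℝ)
      = (∑ x ∈ N, {ω | x ∈ A ω}.indicator (fun _ => (1 : ℝ))) ω := by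
  classical
  rw [Finset.sum_apply, traceOn, Finset.card_filter]
  push_cast
  refine Finset.sum_congr rfl fun x _ => ?_
  simp [Set.indicator_apply]

lemma exists_traceOn_mem_eq_preimage {Ω : Type*} (A : Ω → Set ℕ) (F : Finset ℕ)
    (𝒮 : Set (Finset ℕ)) :
    ∃ s : Set (F → ℕ), {ω | traceOn F (A ω) ∈ 𝒮}
      = (fun ω (i : F) => {ω | (i : ℕ) ∈ A ω}.indicator (fun _ => 1) ω) ⁻¹' s := by
  classical
  refine ⟨{v | ({i : F | v i = 1} : Finset F).map (Function.Embedding.subtype _) ∈ 𝒮}, ?_⟩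
  ext ω
  simp only [Set.mem_ofPred_eq, Set.mem_preimage]
  convert Iff.rfl using 2
  ext x
  simp [mem_traceOn, Set.indicator_apply, and_comm]

variable {Ω : Type*} [MeasurableSpace Ω] {P : Measure Ω} {A : Ω → Set ℕ}

lemma measureReal_card_traceOn_lt_le [IsProbabilityMeasure P]
    (hA : ∀ x, MeasurableSet {ω | x ∈ A ω}) (hind : iIndepSet (fun x => {ω | x ∈ A ω}) P)
    {N : Finset ℕ} {p K : ℝ} (hp : ∀ x ∈ N, p ≤ P.real {ω | x ∈ A ω}) (hK : K ≤ N.card * p) :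
    P.real {ω | ((traceOn N (A ω)).card : ℝ) < K / 4} ≤ exp (-(K / 4)) := by
  set X : ℕ → Ω → ℝ := fun x => {ω | x ∈ A ω}.indicator (fun _ => (1 : ℝ)) with hX
  have hmeas : ∀ x, Measurable (X x) := fun x => measurable_const.indicator (hA x)
  have hindX : iIndepFun X P := hind.iIndepFun_indicator
  have hval : ∀ x ω, 0 ≤ X x ω ∧ X x ω ≤ 1 := fun x ω => by
    by_cases h : x ∈ A ω <;> simp [hX, h]
  have hexp : ∀ x ω, exp (-1 * X x ω) = 1 - (1 - exp (-1)) * X x ω := fun x ω => by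
    by_cases h : x ∈ A ω <;> simp [hX, h]
  have he : exp (-1) ≤ 1 / 2 := by
    rw [exp_neg, inv_eq_one_div]
    exact one_div_le_one_div_of_le (by norm_num) (by linarith [add_one_le_exp (1 : ℝ)])
  have hint : ∀ x, Integrable (X x) P := fun x =>
    (integrable_const (1 : ℝ)).indicator (hA x)
  have hmgf : ∀ x ∈ N, mgf (X x) P (-1) ≤ exp (-(p / 2)) := fun x hx => by
    have h1 : mgf (X x) P (-1) = 1 - (1 - exp (-1)) * P.real {ω | x ∈ A ω} := by
      simp only [mgf, hexp]
      rw [integral_sub (integrable_const _) ((hint x).const_mul _), integral_const_mul]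
      simp [hX, integral_indicator_const _ (hA x)]
    have h2 := hp x hx
    have h3 : (0 : ℝ) ≤ P.real {ω | x ∈ A ω} := measureReal_nonneg
    have h4 := add_one_le_exp (-(p / 2))
    rw [h1]
    nlinarith
  have hsum : mgf (∑ x ∈ N, X x) P (-1) ≤ exp (-(K / 2)) := by
    rw [hindX.mgf_sum hmeas]
    calc ∏ x ∈ N, mgf (X x) P (-1) ≤ ∏ _x ∈ N, exp (-(p / 2)) :=
          Finset.prod_le_prod (fun _ _ => mgf_nonneg) hmgf
      _ = exp (N.card * (-(p / 2))) := by rw [Finset.prod_const, ← exp_nat_mul]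
      _ ≤ exp (-(K / 2)) := exp_le_exp.2 (by linarith)
  have hInt : Integrable (fun ω => exp (-1 * (∑ x ∈ N, X x) ω)) P := by
    refine Integrable.of_bound (C := 1) ?_ (Filter.Eventually.of_forall fun ω => ?_)
    · have : Measurable fun ω => (∑ x ∈ N, X x) ω := by
        simp only [Finset.sum_apply]
        exact Finset.measurable_sum _ fun x _ => hmeas x
      exact (measurable_exp.comp (this.const_mul _)).aestronglyMeasurable
    · rw [norm_eq_abs, abs_exp, exp_le_one_iff, Finset.sum_apply]
      have : 0 ≤ ∑ x ∈ N, X x ω := Finset.sum_nonneg fun x _ => (hval x ω).1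
      linarith
  calc P.real {ω | ((traceOn N (A ω)).card : ℝ) < K / 4}
      ≤ P.real {ω | (∑ x ∈ N, X x) ω ≤ K / 4} := by
        refine measureReal_mono fun ω hω => ?_
        rw [Set.mem_ofPred_eq, card_traceOn_eq_sum_indicator] at hω
        exact hω.le
    _ ≤ exp (-(-1) * (K / 4)) * mgf (∑ x ∈ N, X x) P (-1) :=
        measure_le_le_exp_mul_mgf _ (by norm_num) hInt
    _ ≤ exp (-(-1) * (K / 4)) * exp (-(K / 2)) := by gcongr
    _ = exp (-(K / 4)) := by rw [← exp_add]; congr 1; ring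

lemma measurableSet_traceOn_mem (hA : ∀ x, MeasurableSet {ω | x ∈ A ω}) (F : Finset ℕ)
    (𝒮 : Set (Finset ℕ)) : MeasurableSet {ω | traceOn F (A ω) ∈ 𝒮} := by
  obtain ⟨s, hs⟩ := exists_traceOn_mem_eq_preimage A F 𝒮
  rw [hs]
  have hf : Measurable fun ω (i : F) => {ω | (i : ℕ) ∈ A ω}.indicator (fun _ => 1) ω :=
    measurable_pi_lambda _ fun i => measurable_const.indicator (hA i)
  exact hf s.to_countable.measurableSet

lemma measure_traceOn_inter (hA : ∀ x, MeasurableSet {ω | x ∈ A ω})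
    (hind : iIndepSet (fun x => {ω | x ∈ A ω}) P) {F F' : Finset ℕ} (hF : Disjoint F F')
    (𝒮 𝒯 : Set (Finset ℕ)) :
    P ({ω | traceOn F (A ω) ∈ 𝒮} ∩ {ω | traceOn F' (A ω) ∈ 𝒯})
      = P {ω | traceOn F (A ω) ∈ 𝒮} * P {ω | traceOn F' (A ω) ∈ 𝒯} := by
  obtain ⟨s, hs⟩ := exists_traceOn_mem_eq_preimage A F 𝒮
  obtain ⟨t, ht⟩ := exists_traceOn_mem_eq_preimage A F' 𝒯
  rw [hs, ht]
  have hfun : iIndepFun (fun x => {ω | x ∈ A ω}.indicator fun _ => 1) P :=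
    hind.iIndepFun_indicator (m := (inferInstance : MeasurableSpace ℕ))
  have h := hfun.indepFun_finset F F' hF fun i => measurable_const.indicator (hA i)
  exact h.measure_inter_preimage_eq_mul s t s.to_countable.measurableSet
    t.to_countable.measurableSet

lemma measureReal_exposed_card_traceOn_lt_le [IsProbabilityMeasure P]
    (hA : ∀ x, MeasurableSet {ω | x ∈ A ω}) (hind : iIndepSet (fun x => {ω | x ∈ A ω}) P)
    {F F' : Finset ℕ} (hF : Disjoint F F') {good : Set (Finset ℕ)} {N : Finset ℕ → Finset ℕ}
    {p K : ℝ} (hN : ∀ S ∈ good, S ⊆ F → N S ⊆ F' ∧ K ≤ (N S).card * p)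
    (hp : ∀ x ∈ F', p ≤ P.real {ω | x ∈ A ω}) :
    P.real {ω | traceOn F (A ω) ∈ good ∧
      ((traceOn (N (traceOn F (A ω))) (A ω)).card : ℝ) < K / 4} ≤ exp (-(K / 4)) := by
  classical
  set I : Finset (Finset ℕ) := {S ∈ F.powerset | S ∈ good} with hI
  set E : Finset ℕ → Set Ω := fun S => {ω | traceOn F (A ω) ∈ ({S} : Set (Finset ℕ))} with hE
  set D : Finset ℕ → Set Ω := fun S => {ω | ((traceOn (N S) (A ω)).card : ℝ) < K / 4} with hD
  have hstep : ∀ S ∈ I, P.real (E S ∩ D S) ≤ P.real (E S) * exp (-(K / 4)) := fun S hS => by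
    obtain ⟨hSF, hSg⟩ := Finset.mem_filter.1 hS
    obtain ⟨hNF, hK⟩ := hN S hSg (Finset.mem_powerset.1 hSF)
    have hdisj : Disjoint F (N S) := hF.mono_right hNF
    have h : P (E S ∩ D S) = P (E S) * P (D S) :=
      measure_traceOn_inter hA hind hdisj {S} {T | (T.card : ℝ) < K / 4}
    rw [measureReal_def, h, ENNReal.toReal_mul]
    exact mul_le_mul_of_nonneg_left
      (measureReal_card_traceOn_lt_le hA hind (fun x hx => hp x (hNF hx)) hK) measureReal_nonneg
  have htotal : ∑ S ∈ I, P.real (E S) ≤ 1 := by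
    rw [← measureReal_biUnion_finset]
    · exact measureReal_le_one
    · intro S _ T _ hST
      refine Set.disjoint_left.2 fun ω h1 h2 => hST ?_
      exact (Set.mem_singleton_iff.1 h1).symm.trans h2
    · exact fun S _ => measurableSet_traceOn_mem hA F {S}
  calc _ ≤ P.real (⋃ S ∈ I, E S ∩ D S) := by
        refine measureReal_mono (fun ω hω => ?_) (measure_ne_top _ _)
        simp only [Set.mem_iUnion]
        exact ⟨traceOn F (A ω), by simp [hI, traceOn_subset, hω.1], rfl, hω.2⟩
    _ ≤ ∑ S ∈ I, P.real (E S ∩ D S) := measureReal_biUnion_finset_le _ _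
    _ ≤ ∑ S ∈ I, P.real (E S) * exp (-(K / 4)) := Finset.sum_le_sum hstep
    _ = (∑ S ∈ I, P.real (E S)) * exp (-(K / 4)) := by rw [Finset.sum_mul]
    _ ≤ exp (-(K / 4)) := mul_le_of_le_one_left (exp_pos _).le htotal

open Classical in
/-- Pairs of elements of `A ω` with sum `z` and components in `F₁`, `F₂` are pairwise disjoint,
so it is unlikely that there are many of them. -/
lemma measureReal_card_pairs_ge_le [IsProbabilityMeasure P]
    (hind : iIndepSet (fun x => {ω | x ∈ A ω}) P) {F₁ F₂ : Finset ℕ} (hF : Disjoint F₁ F₂)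
    {q₁ q₂ : ℝ} (h₁ : ∀ x ∈ F₁, P.real {ω | x ∈ A ω} ≤ q₁)
    (h₂ : ∀ x ∈ F₂, P.real {ω | x ∈ A ω} ≤ q₂) (hq₁ : 0 ≤ q₁) (hq₂ : 0 ≤ q₂) (z m : ℕ) :
    P.real {ω | m ≤ ({x ∈ traceOn F₁ (A ω) ×ˢ traceOn F₂ (A ω) | x.1 + x.2 = z}).card}
      ≤ (F₁.card * (q₁ * q₂)) ^ m := by
  set J : Finset (Finset ℕ) :=
    {T ∈ F₁.powersetCard m | ∀ x ∈ T, x ≤ z ∧ z - x ∈ F₂} with hJ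
  set E : Finset ℕ → Set Ω := fun T =>
    ⋂ x ∈ T ∪ T.image (z - ·), {ω | x ∈ A ω} with hE
  have hstep : ∀ T ∈ J, P.real (E T) ≤ (q₁ * q₂) ^ m := fun T hT => by
    obtain ⟨hT1, hT2⟩ := Finset.mem_filter.1 hT
    obtain ⟨hTF, hTm⟩ := Finset.mem_powersetCard.1 hT1
    have himg : T.image (z - ·) ⊆ F₂ := by
      intro y hy
      obtain ⟨x, hx, rfl⟩ := Finset.mem_image.1 hy
      exact (hT2 x hx).2
    have hdisj : Disjoint T (T.image (z - ·)) := hF.mono hTF himg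
    have hinj : (T : Set ℕ).InjOn (z - ·) := by
      intro a ha b hb hab
      have := (hT2 a ha).1
      have := (hT2 b hb).1
      simp only at hab
      omega
    rw [measureReal_def, hE, hind.meas_biInter, ENNReal.toReal_prod,
      Finset.prod_union hdisj, mul_pow]
    refine mul_le_mul ?_ ?_ (Finset.prod_nonneg fun _ _ => ENNReal.toReal_nonneg) (by positivity)
    · exact (Finset.prod_le_prod (fun _ _ => ENNReal.toReal_nonneg)
        fun x hx => h₁ x (hTF hx)).trans_eq (by rw [Finset.prod_const, hTm])
    · refine (Finset.prod_le_prod (fun _ _ => ENNReal.toReal_nonneg)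
        fun x hx => h₂ x (himg hx)).trans_eq ?_
      rw [Finset.prod_const, Finset.card_image_of_injOn hinj, hTm]
  have hcover : {ω | m ≤ ({x ∈ traceOn F₁ (A ω) ×ˢ traceOn F₂ (A ω) | x.1 + x.2 = z}).card}
      ⊆ ⋃ T ∈ J, E T := by
    intro ω hω
    set W := {x ∈ traceOn F₁ (A ω) ×ˢ traceOn F₂ (A ω) | x.1 + x.2 = z} with hW
    have hW' : ∀ x ∈ W.image Prod.fst, (x ∈ F₁ ∧ x ∈ A ω) ∧ x ≤ z ∧ z - x ∈ F₂ ∧ z - x ∈ A ω := by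
      intro x hx
      obtain ⟨⟨a, b⟩, hab, rfl⟩ := Finset.mem_image.1 hx
      simp only [hW, Finset.mem_filter, Finset.mem_product, mem_traceOn] at hab
      obtain ⟨⟨ha, hb⟩, rfl⟩ := hab
      simpa using ⟨ha, hb⟩
    have hcard : (W.image Prod.fst).card = W.card := by
      refine Finset.card_image_of_injOn fun a ha b hb hab => ?_
      have h1 := (Finset.mem_filter.1 ha).2
      have h2 := (Finset.mem_filter.1 hb).2
      exact Prod.ext hab (by omega)
    obtain ⟨T, hTW, hTm⟩ := Finset.exists_subset_card_eq (hcard.symm ▸ hω :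
      m ≤ (W.image Prod.fst).card)
    simp only [Set.mem_iUnion]
    refine ⟨T, ?_, ?_⟩
    · rw [hJ, Finset.mem_filter, Finset.mem_powersetCard]
      exact ⟨⟨fun x hx => (hW' x (hTW hx)).1.1, hTm⟩,
        fun x hx => ⟨(hW' x (hTW hx)).2.1, (hW' x (hTW hx)).2.2.1⟩⟩
    · simp only [hE, Set.mem_iInter, Finset.mem_union, Finset.mem_image]
      rintro x (hx | ⟨y, hy, rfl⟩)
      · exact (hW' x (hTW hx)).1.2
      · exact (hW' y (hTW hy)).2.2.2
  calc _ ≤ P.real (⋃ T ∈ J, E T) := measureReal_mono hcover (measure_ne_top _ _)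
    _ ≤ ∑ T ∈ J, P.real (E T) := measureReal_biUnion_finset_le _ _
    _ ≤ J.card * (q₁ * q₂) ^ m := by
        rw [← nsmul_eq_mul]
        exact Finset.sum_le_card_nsmul _ _ _ hstep
    _ ≤ (F₁.card : ℝ) ^ m * (q₁ * q₂) ^ m := by
        gcongr
        have h : J.card ≤ F₁.card ^ m :=
          (Finset.card_filter_le _ _).trans
            ((Finset.card_powersetCard m F₁).trans_le (Nat.choose_le_pow _ _))
        exact_mod_cast h
    _ = (F₁.card * (q₁ * q₂)) ^ m := (mul_pow _ _ _).symm

end RandomSubset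

section ResidueClass

/-- The integers of a real interval lying in a fixed residue class. -/
def residueIoc (M : ℕ) (r : ZMod M) (a b : ℝ) : Finset ℕ :=
  {x ∈ Finset.Ioc ⌈a⌉₊ ⌊b⌋₊ | (x : ZMod M) = r}

lemma mem_residueIoc {M : ℕ} {r : ZMod M} {a b : ℝ} {x : ℕ} (hx : x ∈ residueIoc M r a b) :
    0 < x ∧ a ≤ x ∧ (x : ℝ) ≤ b ∧ (x : ZMod M) = r := by
  simp only [residueIoc, Finset.mem_filter, Finset.mem_Ioc] at hx
  obtain ⟨⟨h1, h2⟩, h3⟩ := hx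
  have h0 : 0 < x := by omega
  exact ⟨h0, Nat.ceil_le.1 h1.le, (Nat.le_floor_iff' h0.ne').1 h2, h3⟩

lemma card_residueIoc_le {M : ℕ} (r : ZMod M) (a : ℝ) {b : ℝ} (hb : 0 ≤ b) :
    ((residueIoc M r a b).card : ℝ) ≤ b := by
  have h : (residueIoc M r a b).card ≤ ⌊b⌋₊ :=
    (Finset.card_filter_le _ _).trans (by simp)
  exact (Nat.cast_le.2 h).trans (Nat.floor_le hb)

lemma le_card_residueIoc {M : ℕ} (hM : 1 ≤ M) (r : ZMod M) {a b : ℝ} (ha : 0 ≤ a) :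
    (b - a) / M - 3 ≤ (residueIoc M r a b).card := by
  have : NeZero M := ⟨by omega⟩
  have hM' : (1 : ℝ) ≤ M := by exact_mod_cast hM
  have hcard := Nat.Ioc_filter_modEq_card ⌈a⌉₊ ⌊b⌋₊ (r := M) (by omega) r.val
  have heq : residueIoc M r a b = {x ∈ Finset.Ioc ⌈a⌉₊ ⌊b⌋₊ | x ≡ r.val [MOD M]} := by
    refine Finset.filter_congr fun x _ => ?_
    rw [← ZMod.natCast_eq_natCast_iff, ZMod.natCast_zmod_val]
  rw [← heq] at hcard
  set u : ℚ := ((⌊b⌋₊ : ℚ) - r.val) / M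
  set w : ℚ := ((⌈a⌉₊ : ℚ) - r.val) / M
  have h1 : ((⌊u⌋ - ⌊w⌋ : ℤ) : ℚ) ≤ ((residueIoc M r a b).card : ℚ) := by
    have : (⌊u⌋ - ⌊w⌋ : ℤ) ≤ ((residueIoc M r a b).card : ℤ) := by
      rw [hcard]; exact le_max_left _ _
    exact_mod_cast this
  have h2 : u - 1 < ⌊u⌋ := Int.sub_one_lt_floor u
  have h3 : (⌊w⌋ : ℚ) ≤ w := Int.floor_le w
  push_cast at h1
  have h4 : u - w - 1 ≤ ((residueIoc M r a b).card : ℚ) := by linarith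
  have h5 : u - w = ((⌊b⌋₊ : ℚ) - ⌈a⌉₊) / M := by
    simp only [u, w]; ring
  rw [h5] at h4
  have h6 : ((⌊b⌋₊ : ℝ) - ⌈a⌉₊) / M - 1 ≤ ((residueIoc M r a b).card : ℝ) := by
    exact_mod_cast h4
  have h7 : b - 1 < ⌊b⌋₊ := Nat.sub_one_lt_floor b
  have h8 : (⌈a⌉₊ : ℝ) < a + 1 := Nat.ceil_lt_add_one ha
  have h9 : (b - a - 2) / M ≤ ((⌊b⌋₊ : ℝ) - ⌈a⌉₊) / M :=
    div_le_div_of_nonneg_right (by linarith) (by positivity)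
  have h10 : (2 : ℝ) / M ≤ 2 := div_le_self (by norm_num) hM'
  rw [sub_div] at h9
  linarith

end ResidueClass

lemma card_le_ncard_Rn {g M : ℕ} {lam : ℝ} {s : ℕ → Fin 3 → ZMod M} {n : ℕ}
    (h02 : s n 0 ≠ s n 2) (h12 : s n 1 ≠ s n 2) {B : Set ℕ} {T : Finset ℕ}
    (hT : ∀ y ∈ T, y ∈ B ∧ ∃ x₁ ∈ B, ∃ x₂ ∈ B, Rtrip g M lam s n x₁ x₂ y) :
    T.card ≤ Set.ncard {w ∈ Rn g M lam s n | (w : Set ℕ) ⊆ B} := by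
  have hT' : ∀ y, ∃ p : ℕ × ℕ, y ∈ T → p.1 ∈ B ∧ p.2 ∈ B ∧ Rtrip g M lam s n p.1 p.2 y := by
    intro y
    by_cases hy : y ∈ T
    · obtain ⟨-, x₁, h1, x₂, h2, h⟩ := hT y hy
      exact ⟨(x₁, x₂), fun _ => ⟨h1, h2, h⟩⟩
    · exact ⟨(0, 0), fun h => absurd h hy⟩
  choose p hp using hT'
  rw [← Set.ncard_coe_finset T]
  refine Set.ncard_le_ncard_of_injOn (fun y => ({(p y).1, (p y).2, y} : Finset ℕ)) ?_ ?_ ?_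
  · intro y hy
    obtain ⟨h1, h2, h⟩ := hp y hy
    refine ⟨⟨_, _, _, rfl, h⟩, ?_⟩
    intro x hx
    simp only [Finset.coe_insert, Finset.coe_singleton, Set.mem_insert_iff,
      Set.mem_singleton_iff] at hx
    rcases hx with rfl | rfl | rfl
    exacts [h1, h2, (hT _ hy).1]
  · intro y hy y' hy' h
    have hmem : y ∈ ({(p y').1, (p y').2, y'} : Finset ℕ) := by
      simp only at h
      rw [← h]; simp
    have hr : (y : ZMod M) = s n 2 := (hp y hy).2.2.2.2.2.2.2.2.2.2.2.2.2.2
    obtain ⟨-, -, -, -, -, -, -, -, -, -, -, -, hr1, hr2, -⟩ := hp y' hy'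
    simp only [Finset.mem_insert, Finset.mem_singleton] at hmem
    rcases hmem with h' | h' | h'
    · exact absurd (by rw [← hr1, ← h', hr]) h02
    · exact absurd (by rw [← hr2, ← h', hr]) h12
    · exact h'
  · refine (Finset.finite_toSet (Finset.range (n + 1)).powerset).subset ?_
    rintro w ⟨⟨x₁, x₂, x₃, rfl, h⟩, -⟩
    have hsum := h.2.2.2.1
    simp only [Finset.coe_powerset, Set.mem_preimage, Set.mem_powerset_iff]
    intro x hx
    simp only [Finset.coe_insert, Finset.coe_singleton, Set.mem_insert_iff,
      Set.mem_singleton_iff] at hx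
    simp only [Finset.coe_range, Set.mem_Iio]
    omega

lemma measureReal_ncard_Rn_lt_le {g M : ℕ} (hM : 1 ≤ M) {lam : ℝ} (hlam : 0 < lam)
    {s : ℕ → Fin 3 → ZMod M} {n : ℕ} (hn : 1 ≤ n)
    (h01 : s n 0 ≠ s n 1) (h02 : s n 0 ≠ s n 2) (h12 : s n 1 ≠ s n 2)
    (hs : s n 0 + s n 1 + s n 2 = (n : ZMod M))
    {Ω : Type*} [MeasurableSpace Ω] {P : Measure Ω} [IsProbabilityMeasure P] {A : Ω → Set ℕ}
    (hA : ∀ x, MeasurableSet {ω | x ∈ A ω}) (hind : iIndepSet (fun x => {ω | x ∈ A ω}) P)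
    (hP : ∀ x : ℕ, 0 < x → ∀ i, (x : ZMod M) = s n i →
      P.real {ω | x ∈ A ω} = lam⁻¹ * (x : ℝ) ^ (-alph g))
    {G K₁ K₂ K₃ : ℝ} (hG : G = glam g lam n) (hGM : 12 * M ≤ G) (hGn : G ≤ n / 8)
    (hK₁ : K₁ = G / (4 * M) * (lam⁻¹ * G ^ (-alph g)))
    (hK₂ : K₂ = n / (8 * M) * (lam⁻¹ * (n : ℝ) ^ (-alph g)))
    (hK₃ : K₃ = K₁ / 4 * (K₂ / 4) / 8 * (lam⁻¹ * (n : ℝ) ^ (-alph g)))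
    (hlog₁ : 2 * Real.log n ≤ K₁ / 4) (hlog₂ : 2 * Real.log n ≤ K₂ / 4)
    (hlog₃ : 2 * Real.log n ≤ K₃ / 4)
    (hq : G * (lam⁻¹ * (G / 2) ^ (-alph g) * (lam⁻¹ * ((n : ℝ) / 4) ^ (-alph g)))
      ≤ (n : ℝ) ^ (-(1 / 3) : ℝ)) :
    P.real {ω | (Set.ncard {w ∈ Rn g M lam s n | (w : Set ℕ) ⊆ A ω} : ℝ) < K₃ / 4}
      ≤ 5 * ((n : ℝ) ^ 2)⁻¹ := by
  classical
  have hM' : (1 : ℝ) ≤ M := by exact_mod_cast hM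
  have hn' : (1 : ℝ) ≤ n := by exact_mod_cast hn
  have hG0 : 0 < G := by linarith
  have halph : 0 ≤ alph g := by unfold alph; positivity
  have hlog : ∀ {K : ℝ}, 2 * Real.log n ≤ K → exp (-K) ≤ ((n : ℝ) ^ 2)⁻¹ := fun {K} hK => by
    calc exp (-K) ≤ exp (-(2 * Real.log n)) := exp_le_exp.2 (by linarith)
      _ = ((n : ℝ) ^ 2)⁻¹ := by
        rw [exp_neg, mul_comm, exp_mul, exp_log (by linarith)]
        norm_cast
  set F₁ := residueIoc M (s n 0) (G / 2) G with hF₁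
  set F₂ := residueIoc M (s n 1) ((n : ℝ) / 4) (n / 2) with hF₂
  set F₃ : Finset ℕ := {x ∈ Finset.Icc 1 n | (x : ZMod M) = s n 2} with hF₃
  have m₁ : ∀ x ∈ F₁, 0 < x ∧ G / 2 ≤ x ∧ (x : ℝ) ≤ G ∧ (x : ZMod M) = s n 0 :=
    fun x => mem_residueIoc
  have m₂ : ∀ x ∈ F₂, 0 < x ∧ (n : ℝ) / 4 ≤ x ∧ (x : ℝ) ≤ n / 2 ∧ (x : ZMod M) = s n 1 :=
    fun x => mem_residueIoc
  have m₃ : ∀ x ∈ F₃, (0 < x ∧ x ≤ n) ∧ (x : ZMod M) = s n 2 := fun x hx => by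
    simpa [hF₃, Nat.succ_le_iff] using hx
  have d₁₂ : Disjoint F₁ F₂ := Finset.disjoint_left.2 fun x h1 h2 =>
    h01 ((m₁ x h1).2.2.2.symm.trans (m₂ x h2).2.2.2)
  have d₃ : Disjoint (F₁ ∪ F₂) F₃ := Finset.disjoint_left.2 fun x h1 h3 => by
    rcases Finset.mem_union.1 h1 with h1 | h1
    · exact h02 ((m₁ x h1).2.2.2.symm.trans (m₃ x h3).2)
    · exact h12 ((m₂ x h1).2.2.2.symm.trans (m₃ x h3).2)
  have pmono : ∀ {x y : ℝ}, 0 < x → x ≤ y →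
      lam⁻¹ * y ^ (-alph g) ≤ lam⁻¹ * x ^ (-alph g) := fun hx hxy =>
    mul_le_mul_of_nonneg_left (rpow_le_rpow_of_nonpos hx hxy (by linarith)) (by positivity)
  have hp : ∀ x ∈ F₃, lam⁻¹ * (n : ℝ) ^ (-alph g) ≤ P.real {ω | x ∈ A ω} := fun x hx => by
    obtain ⟨⟨h0, hxn⟩, hr⟩ := m₃ x hx
    rw [hP x h0 2 hr]
    exact pmono (by exact_mod_cast h0) (by exact_mod_cast hxn)
  set W : Finset ℕ → Finset (ℕ × ℕ) := fun S => (S ∩ F₁) ×ˢ (S ∩ F₂) with hW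
  set N : Finset ℕ → Finset ℕ := fun S => (W S).image fun p => n - p.1 - p.2 with hN
  set good : Set (Finset ℕ) := {S | K₁ / 4 ≤ (S ∩ F₁).card ∧ K₂ / 4 ≤ (S ∩ F₂).card ∧
    ∀ z ∈ Finset.range (n + 1), ({p ∈ W S | p.1 + p.2 = z}).card ≤ 8} with hgood
  have hW' : ∀ S, ∀ p ∈ W S, Rtrip g M lam s n p.1 p.2 (n - p.1 - p.2) ∧
      p.1 + p.2 ≤ n := fun S p hpS => by
    obtain ⟨h1, h2⟩ := Finset.mem_product.1 hpS
    obtain ⟨a0, a1, a2, a3⟩ := m₁ _ (Finset.mem_inter.1 h1).2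
    obtain ⟨b0, b1, b2, b3⟩ := m₂ _ (Finset.mem_inter.1 h2).2
    have hle : p.1 + p.2 ≤ n := by
      have : ((p.1 : ℝ) + p.2) ≤ n := by linarith
      exact_mod_cast this
    obtain ⟨y, hy⟩ := Nat.exists_eq_add_of_le hle
    have hyn : n - p.1 - p.2 = y := by omega
    have hy' : (n : ℝ) = p.1 + p.2 + y := by exact_mod_cast hy
    have hy0 : (0 : ℝ) < y := by linarith
    have hyr : (y : ZMod M) = s n 2 := by
      have h : (n : ZMod M) = p.1 + p.2 + y := by exact_mod_cast congrArg (Nat.cast (R := ZMod M)) hy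
      rw [← hs, a3, b3] at h
      exact (add_left_cancel h).symm
    rw [hyn]
    exact ⟨⟨a0, b0, by exact_mod_cast hy0, hy.symm, hG ▸ a1, hG ▸ a2, b1, by omega, by linarith,
      by omega, a3, b3, hyr⟩, hle⟩
  have hNgood : ∀ S ∈ good, S ⊆ F₁ ∪ F₂ →
      N S ⊆ F₃ ∧ K₃ ≤ (N S).card * (lam⁻¹ * (n : ℝ) ^ (-alph g)) := by
    rintro S ⟨hS1, hS2, hS3⟩ -
    constructor
    · intro y hy
      obtain ⟨p, hpW, rfl⟩ := Finset.mem_image.1 hy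
      obtain ⟨-, -, h0, hsum, -, -, -, -, -, -, -, -, hr⟩ := (hW' S p hpW).1
      simp only [hF₃, Finset.mem_filter, Finset.mem_Icc]
      exact ⟨⟨h0, by omega⟩, hr⟩
    · have hcard : (W S).card ≤ 8 * (N S).card := by
        refine Finset.card_le_mul_card_image _ _ fun y _ => ?_
        refine (Finset.card_le_card fun p hpy => ?_).trans
          (hS3 (n - y) (Finset.mem_range.2 (by omega)))
        obtain ⟨h1, h2⟩ := Finset.mem_filter.1 hpy
        have := (hW' S p h1).2
        exact Finset.mem_filter.2 ⟨h1, by omega⟩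
      have hcard' : ((S ∩ F₁).card : ℝ) * (S ∩ F₂).card ≤ 8 * (N S).card := by
        rw [hW, Finset.card_product] at hcard
        exact_mod_cast hcard
      have hK₂0 : 0 ≤ K₂ / 4 := by rw [hK₂]; positivity
      have hmul : K₁ / 4 * (K₂ / 4) ≤ ((S ∩ F₁).card : ℝ) * (S ∩ F₂).card := by gcongr
      rw [hK₃]
      exact mul_le_mul_of_nonneg_right (by linarith) (by positivity)
  have c₁ : K₁ ≤ F₁.card * (lam⁻¹ * G ^ (-alph g)) := by
    rw [hK₁]
    refine mul_le_mul_of_nonneg_right ?_ (by positivity)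
    have h := le_card_residueIoc hM (s n 0) (a := G / 2) (b := G) (by positivity)
    have h' : 3 ≤ G / (4 * M) := by rw [le_div_iff₀ (by positivity)]; linarith
    have h'' : (G - G / 2) / M = G / (4 * M) + G / (4 * M) := by field_simp; ring
    linarith
  have c₂ : K₂ ≤ F₂.card * (lam⁻¹ * (n : ℝ) ^ (-alph g)) := by
    rw [hK₂]
    refine mul_le_mul_of_nonneg_right ?_ (by positivity)
    have h := le_card_residueIoc hM (s n 1) (a := (n : ℝ) / 4) (b := n / 2) (by positivity)
    have h' : 3 ≤ (n : ℝ) / (8 * M) := by rw [le_div_iff₀ (by positivity)]; linarith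
    have h'' : ((n : ℝ) / 2 - n / 4) / M = n / (8 * M) + n / (8 * M) := by field_simp; ring
    linarith
  set D₁ : Set Ω := {ω | ((traceOn F₁ (A ω)).card : ℝ) < K₁ / 4} with hD₁
  set D₂ : Set Ω := {ω | ((traceOn F₂ (A ω)).card : ℝ) < K₂ / 4} with hD₂
  set D₃ : Set Ω := {ω | traceOn (F₁ ∪ F₂) (A ω) ∈ good ∧
      ((traceOn (N (traceOn (F₁ ∪ F₂) (A ω))) (A ω)).card : ℝ) < K₃ / 4} with hD₃
  set D₄ : ℕ → Set Ω := fun z => {ω | 9 ≤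
    ({x ∈ traceOn F₁ (A ω) ×ˢ traceOn F₂ (A ω) | x.1 + x.2 = z}).card} with hD₄
  have b₁ : P.real D₁ ≤ ((n : ℝ) ^ 2)⁻¹ := by
    refine (measureReal_card_traceOn_lt_le hA hind (fun x hx => ?_) c₁).trans (hlog hlog₁)
    obtain ⟨h0, -, h2, hr⟩ := m₁ x hx
    rw [hP x h0 0 hr]
    exact pmono (by exact_mod_cast h0) h2
  have b₂ : P.real D₂ ≤ ((n : ℝ) ^ 2)⁻¹ := by
    refine (measureReal_card_traceOn_lt_le hA hind (fun x hx => ?_) c₂).trans (hlog hlog₂)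
    obtain ⟨h0, -, h2, hr⟩ := m₂ x hx
    rw [hP x h0 1 hr]
    exact pmono (by exact_mod_cast h0) (by linarith)
  have b₃ : P.real D₃ ≤ ((n : ℝ) ^ 2)⁻¹ :=
    (measureReal_exposed_card_traceOn_lt_le hA hind d₃ hNgood hp).trans (hlog hlog₃)
  have b₄ : ∀ z, P.real (D₄ z) ≤ ((n : ℝ) ^ 3)⁻¹ := fun z => by
    have h := measureReal_card_pairs_ge_le hind d₁₂ (q₁ := lam⁻¹ * (G / 2) ^ (-alph g))
      (q₂ := lam⁻¹ * ((n : ℝ) / 4) ^ (-alph g))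
      (fun x hx => by
        obtain ⟨h0, h1, -, hr⟩ := m₁ x hx
        rw [hP x h0 0 hr]
        exact pmono (by positivity) h1)
      (fun x hx => by
        obtain ⟨h0, h1, -, hr⟩ := m₂ x hx
        rw [hP x h0 1 hr]
        exact pmono (by positivity) h1) (by positivity) (by positivity) z 9
    refine h.trans ?_
    calc _ ≤ ((n : ℝ) ^ (-(1 / 3) : ℝ)) ^ 9 := by
          refine pow_le_pow_left₀ (by positivity) (le_trans ?_ hq) 9
          exact mul_le_mul_of_nonneg_right (card_residueIoc_le _ _ hG0.le) (by positivity)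
      _ = ((n : ℝ) ^ 3)⁻¹ := by
          rw [← rpow_natCast, ← rpow_mul (by positivity), ← rpow_natCast, ← rpow_neg (by positivity)]
          norm_num
  have hcover : {ω | (Set.ncard {w ∈ Rn g M lam s n | (w : Set ℕ) ⊆ A ω} : ℝ) < K₃ / 4}
      ⊆ D₁ ∪ D₂ ∪ D₃ ∪ ⋃ z ∈ Finset.range (n + 1), D₄ z := by
    intro ω hω
    by_contra hcon
    simp only [Set.mem_union, Set.mem_iUnion, not_or, not_exists] at hcon
    obtain ⟨⟨⟨n1, n2⟩, n3⟩, n4⟩ := hcon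
    have e₁ : traceOn (F₁ ∪ F₂) (A ω) ∩ F₁ = traceOn F₁ (A ω) := by
      ext x; simp only [Finset.mem_inter, mem_traceOn, Finset.mem_union]; tauto
    have e₂ : traceOn (F₁ ∪ F₂) (A ω) ∩ F₂ = traceOn F₂ (A ω) := by
      ext x; simp only [Finset.mem_inter, mem_traceOn, Finset.mem_union]; tauto
    have hg : traceOn (F₁ ∪ F₂) (A ω) ∈ good := by
      simp only [hgood, hW, Set.mem_ofPred_eq, e₁, e₂]
      refine ⟨not_lt.1 n1, not_lt.1 n2, fun z hz => ?_⟩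
      have := n4 z hz
      simp only [hD₄, Set.mem_ofPred_eq] at this
      convert Nat.le_of_lt_succ (not_le.1 this)
    have hlt : ¬ ((traceOn (N (traceOn (F₁ ∪ F₂) (A ω))) (A ω)).card : ℝ) < K₃ / 4 :=
      fun h => n3 ⟨hg, h⟩
    refine hlt (lt_of_le_of_lt ?_ hω)
    refine Nat.cast_le.2 (card_le_ncard_Rn h02 h12 fun y hy => ?_)
    obtain ⟨hyN, hyA⟩ := mem_traceOn.1 hy
    obtain ⟨p, hpW, rfl⟩ := Finset.mem_image.1 hyN
    have hpW' := hpW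
    simp only [hW, e₁, e₂, Finset.mem_product, mem_traceOn] at hpW'
    exact ⟨hyA, p.1, hpW'.1.2, p.2, hpW'.2.2, (hW' _ p hpW).1⟩
  have hsum : P.real (⋃ z ∈ Finset.range (n + 1), D₄ z) ≤ 2 * ((n : ℝ) ^ 2)⁻¹ := by
    calc _ ≤ ∑ z ∈ Finset.range (n + 1), P.real (D₄ z) := measureReal_biUnion_finset_le _ _
      _ ≤ ∑ _z ∈ Finset.range (n + 1), ((n : ℝ) ^ 3)⁻¹ := Finset.sum_le_sum fun z _ => b₄ z
      _ = ((n : ℝ) + 1) * ((n : ℝ) ^ 3)⁻¹ := by simp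
      _ ≤ (2 * n) * ((n : ℝ) ^ 3)⁻¹ := by gcongr; linarith
      _ = 2 * ((n : ℝ) ^ 2)⁻¹ := by field_simp
  calc _ ≤ P.real (D₁ ∪ D₂ ∪ D₃ ∪ ⋃ z ∈ Finset.range (n + 1), D₄ z) :=
        measureReal_mono hcover (measure_ne_top _ _)
    _ ≤ P.real D₁ + P.real D₂ + P.real D₃ + P.real (⋃ z ∈ Finset.range (n + 1), D₄ z) := by
        refine (measureReal_union_le _ _).trans ?_
        gcongr
        refine (measureReal_union_le _ _).trans ?_
        gcongr
        exact measureReal_union_le _ _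
    _ ≤ 5 * ((n : ℝ) ^ 2)⁻¹ := by linarith

lemma ae_eventually_notMem_of_measureReal_le {Ω : Type*} [MeasurableSpace Ω] {P : Measure Ω}
    [IsFiniteMeasure P] {E : ℕ → Set Ω} {f : ℕ → ℝ} (hf : Summable f)
    (hE : ∀ᶠ n in Filter.atTop, P.real (E n) ≤ f n) :
    ∀ᵐ ω ∂P, ∀ᶠ n in Filter.atTop, ω ∉ E n := by
  obtain ⟨N, hN⟩ := Filter.eventually_atTop.1 hE
  have hsum : ∑' n, P (E (n + N)) ≠ ⊤ := by
    refine ne_top_of_le_ne_top ((summable_nat_add_iff N).2 hf).tsum_ofReal_ne_top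
      (ENNReal.tsum_le_tsum fun n => ?_)
    rw [← ofReal_measureReal]
    exact ENNReal.ofReal_le_ofReal (hN _ (by omega))
  filter_upwards [ae_eventually_notMem hsum] with ω hω
  obtain ⟨N', hN'⟩ := Filter.eventually_atTop.1 hω
  refine Filter.eventually_atTop.2 ⟨N' + N, fun n hn => ?_⟩
  have h := hN' (n - N) (by omega)
  rwa [Nat.sub_add_cancel (by omega)] at h

section Asymptotics

variable {g : ℕ}

lemma one_sub_alph (g : ℕ) : 1 - alph g = (g : ℝ) / (2 * g + 1) := by
  unfold alph
  field_simp
  ring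

lemma one_sub_alph_pos (hg : 2 ≤ g) : 0 < 1 - alph g := by
  rw [one_sub_alph]
  have : 0 < (g : ℝ) := by exact_mod_cast (by omega : 0 < g)
  positivity

lemma glam_pos {lam : ℝ} (hlam : 0 < lam) {n : ℕ} (hn : 2 ≤ n) : 0 < glam g lam n := by
  have hn' : (1 : ℝ) < n := by exact_mod_cast hn
  have := Real.log_pos hn'
  unfold glam
  positivity

lemma glam_rpow (hg : 2 ≤ g) {lam : ℝ} (hlam : 0 < lam) {n : ℕ} (hn : 2 ≤ n) :
    glam g lam n ^ (1 - alph g)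
      = lam ^ (2 * g + 5) * (n : ℝ) ^ (2 * alph g - 1) * Real.log n := by
  have hn' : (1 : ℝ) < n := by exact_mod_cast hn
  have hlog := Real.log_pos hn'
  have hα := one_sub_alph_pos hg
  have hg0 : (0 : ℝ) < g := by exact_mod_cast (by omega : 0 < g)
  unfold glam
  rw [mul_rpow (by positivity) (by positivity), mul_rpow (by positivity) (by positivity),
    ← rpow_mul hlam.le, ← rpow_mul (by positivity), ← rpow_mul hlog.le,
    div_mul_cancel₀ _ hα.ne', div_mul_cancel₀ _ hα.ne', rpow_one]
  congr 2
  · rw [← rpow_natCast]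
    push_cast
    rfl
  · congr 1
    rw [one_sub_alph]
    unfold alph
    field_simp
    ring

open Filter in
lemma eventually_log_rpow_le (κ : ℝ) {s C : ℝ} (hs : 0 < s) (hC : 0 < C) :
    ∀ᶠ n : ℕ in atTop, C * Real.log n ^ κ ≤ (n : ℝ) ^ s := by
  have h := (tendsto_natCast_atTop_atTop (R := ℝ)).eventually
    ((isLittleO_log_rpow_rpow_atTop κ hs).bound (inv_pos.2 hC))
  filter_upwards [h] with n hn
  rw [norm_of_nonneg (rpow_nonneg (Nat.cast_nonneg n) s)] at hn
  have := (le_abs_self _).trans hn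
  rwa [inv_mul_eq_div, le_div_iff₀' hC] at this

open Filter in
lemma eventually_log_le (s C : ℝ) (hs : 0 < s) (hC : 0 < C) :
    ∀ᶠ n : ℕ in atTop, C * Real.log n ≤ (n : ℝ) ^ s := by
  simpa using eventually_log_rpow_le 1 hs hC

open Filter in
lemma eventually_le_rpow {s : ℝ} (hs : 0 < s) (C : ℝ) :
    ∀ᶠ n : ℕ in atTop, C ≤ (n : ℝ) ^ s :=
  ((tendsto_rpow_atTop hs).comp (tendsto_natCast_atTop_atTop (R := ℝ))).eventually_ge_atTop C

open Filter in
lemma eventually_le_glam (hg : 2 ≤ g) {lam : ℝ} (hlam : 1 ≤ lam) (C : ℝ) :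
    ∀ᶠ n : ℕ in atTop, C ≤ glam g lam n := by
  have hg0 : (0 : ℝ) < g := by exact_mod_cast (by omega : 0 < g)
  have hα := one_sub_alph_pos hg
  filter_upwards [eventually_le_rpow (s := 1 / g) (by positivity) C,
    (Real.tendsto_log_atTop.comp (tendsto_natCast_atTop_atTop (R := ℝ))).eventually_ge_atTop 1]
    with n h1 h2
  have h3 : 1 ≤ lam ^ ((2 * (g : ℝ) + 5) / (1 - alph g)) := one_le_rpow hlam (by positivity)
  have h4 : 1 ≤ Real.log n ^ ((1 : ℝ) / (1 - alph g)) := one_le_rpow h2 (by positivity)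
  unfold glam
  calc C ≤ 1 * (n : ℝ) ^ ((1 : ℝ) / g) * 1 := by simpa using h1
    _ ≤ _ := by gcongr

open Filter in
lemma eventually_glam_le (hg : 2 ≤ g) {lam : ℝ} (hlam : 0 < lam) :
    ∀ᶠ n : ℕ in atTop, glam g lam n ≤ n / 8 := by
  have hg2 : (2 : ℝ) ≤ g := by exact_mod_cast hg
  have hs : 0 < 1 - (1 : ℝ) / g := by
    rw [sub_pos, div_lt_one (by linarith)]; linarith
  filter_upwards [eventually_log_rpow_le (1 / (1 - alph g)) hs
    (C := 8 * lam ^ ((2 * (g : ℝ) + 5) / (1 - alph g))) (by positivity), eventually_ge_atTop 1]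
    with n h1 hn
  have hn' : (0 : ℝ) < n := by exact_mod_cast hn
  have h2 : (n : ℝ) = (n : ℝ) ^ ((1 : ℝ) / g) * (n : ℝ) ^ (1 - (1 : ℝ) / g) := by
    rw [← rpow_add hn']; simp
  have h3 := mul_le_mul_of_nonneg_left h1 (rpow_nonneg hn'.le ((1 : ℝ) / g))
  rw [← h2] at h3
  unfold glam
  linarith

end Asymptotics

theorem stmt8 (g M : ℕ) (hg : 2 ≤ g) (hM : 1 ≤ M) (CM : Set (ZMod M))
    (hSidon : IsSidonZ CM) (hcov : Covers3 CM) :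
    ∃ c lam₀ : ℝ, 0 < c ∧ 1 < lam₀ ∧
      ∀ s : ℕ → Fin 3 → ZMod M, GoodS M CM s →
      ∀ lam : ℝ, lam₀ ≤ lam →
      ∀ (Ω : Type) [MeasurableSpace Ω] (P : Measure Ω), IsProbabilityMeasure P →
      ∀ A : Ω → Set ℕ,
        (∀ x : ℕ, MeasurableSet {ω | x ∈ A ω}) →
        iIndepSet (fun x : ℕ => {ω | x ∈ A ω}) P →
        (∀ x : ℕ, 0 < x → (x : ZMod M) ∈ CM →
          P {ω | x ∈ A ω} = ENNReal.ofReal (lam⁻¹ * (x : ℝ) ^ (-alph g))) →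
        (∀ x : ℕ, (x : ZMod M) ∉ CM → P {ω | x ∈ A ω} = 0) →
        P {ω | 0 ∈ A ω} = 0 →
        ∀ᵐ ω ∂P, ∃ N : ℕ, ∀ n : ℕ, N ≤ n →
          c * lam ^ (2 * g + 2) * Real.log n ≤
            (Set.ncard {w ∈ Rn g M lam s n | (w : Set ℕ) ⊆ A ω} : ℝ) := by
  have hM1 : (1 : ℝ) ≤ M := by exact_mod_cast hM
  have hM2 : (1 : ℝ) ≤ (M : ℝ) ^ 2 := one_le_pow₀ hM1
  refine ⟨(16384 * (M : ℝ) ^ 2)⁻¹, 32768 * (M : ℝ) ^ 2, by positivity, by linarith, ?_⟩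
  intro s hs lam hlam Ω _ P hPprob A hA hind hP _ _
  have hlam1 : 1 ≤ lam := by linarith
  have hlam0 : 0 < lam := by linarith
  have hα := one_sub_alph_pos hg
  have hg2 : (2 : ℝ) ≤ g := by exact_mod_cast hg
  have hβ : 0 < 2 * alph g - 1 := by
    have : 2 * alph g - 1 = 1 / (2 * g + 1) := by unfold alph; field_simp; ring
    rw [this]; positivity
  have hγ : 0 < 1 - alph g - 1 / 3 := by
    rw [one_sub_alph, sub_pos, div_lt_div_iff₀ (by norm_num) (by positivity)]
    linarith
  have hα0 : 0 ≤ alph g := by unfold alph; positivity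
  have hPr : ∀ n, ∀ x : ℕ, 0 < x → ∀ i, (x : ZMod M) = s n i →
      P.real {ω | x ∈ A ω} = lam⁻¹ * (x : ℝ) ^ (-alph g) := fun n x hx i hi => by
    rw [measureReal_def, hP x hx (hi ▸ (hs n).1 i), ENNReal.toReal_ofReal (by positivity)]
  have hfail : ∀ᶠ n : ℕ in Filter.atTop,
      P.real {ω | (Set.ncard {w ∈ Rn g M lam s n | (w : Set ℕ) ⊆ A ω} : ℝ)
        < (16384 * (M : ℝ) ^ 2)⁻¹ * lam ^ (2 * g + 2) * Real.log n} ≤ 5 * ((n : ℝ) ^ 2)⁻¹ := by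
    filter_upwards [eventually_le_glam hg hlam1 (12 * M), eventually_glam_le hg hlam0,
      Filter.eventually_ge_atTop 2, eventually_le_rpow hβ (32 * M),
      eventually_log_le (1 - alph g) (64 * M * lam) hα (by positivity),
      eventually_log_le (1 - alph g - 1 / 3) (8 * lam ^ (2 * g + 3)) hγ (by positivity)]
      with n hGM hGn hn hn1 hn2 hn3
    obtain ⟨-, h01, h02, h12, hsum⟩ := hs n
    have hn' : (1 : ℝ) < n := by exact_mod_cast hn
    have hn0 : (0 : ℝ) < n := by linarith
    have hlog := Real.log_pos hn'
    set G := glam g lam n with hG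
    have hG0 : 0 < G := glam_pos hlam0 hn
    have hGpow : G * G ^ (-alph g)
        = lam ^ (2 * g + 5) * (n : ℝ) ^ (2 * alph g - 1) * Real.log n := by
      rw [← glam_rpow hg hlam0 hn, sub_eq_add_neg, rpow_add hG0, rpow_one]
    have hnpow : (n : ℝ) * (n : ℝ) ^ (-alph g) = (n : ℝ) ^ (1 - alph g) := by
      rw [sub_eq_add_neg, rpow_add hn0, rpow_one]
    set K₁ := G / (4 * M) * (lam⁻¹ * G ^ (-alph g)) with hK₁
    set K₂ := (n : ℝ) / (8 * M) * (lam⁻¹ * (n : ℝ) ^ (-alph g)) with hK₂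
    set K₃ := K₁ / 4 * (K₂ / 4) / 8 * (lam⁻¹ * (n : ℝ) ^ (-alph g)) with hK₃
    have e₁ : K₁ = lam ^ (2 * g + 4) * (n : ℝ) ^ (2 * alph g - 1) * Real.log n / (4 * M) := by
      calc K₁ = G * G ^ (-alph g) * lam⁻¹ / (4 * M) := by rw [hK₁]; ring
        _ = _ := by rw [hGpow]; field_simp; ring
    have e₂ : K₂ = (n : ℝ) ^ (1 - alph g) / (8 * M * lam) := by
      calc K₂ = (n : ℝ) * (n : ℝ) ^ (-alph g) / (8 * M * lam) := by rw [hK₂]; field_simp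
        _ = _ := by rw [hnpow]
    have hone : (n : ℝ) ^ (2 * alph g - 1) * (n : ℝ) ^ (1 - alph g) * (n : ℝ) ^ (-alph g) = 1 := by
      rw [← rpow_add hn0, ← rpow_add hn0]
      convert rpow_zero _ using 2
      ring
    have e₃ : K₃ / 4 = (16384 * (M : ℝ) ^ 2)⁻¹ * lam ^ (2 * g + 2) * Real.log n := by
      calc K₃ / 4 = ((n : ℝ) ^ (2 * alph g - 1) * (n : ℝ) ^ (1 - alph g) * (n : ℝ) ^ (-alph g))
            * (lam ^ (2 * g + 4) * Real.log n / (4 * M) / (8 * M * lam) / 512 * lam⁻¹) := by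
            rw [hK₃, e₁, e₂]; ring
        _ = _ := by rw [hone]; field_simp; ring
    have hq : G * (lam⁻¹ * (G / 2) ^ (-alph g) * (lam⁻¹ * ((n : ℝ) / 4) ^ (-alph g)))
        ≤ (n : ℝ) ^ (-(1 / 3) : ℝ) := by
      have h8 : (8 : ℝ) ^ alph g ≤ 8 := by
        simpa using rpow_le_rpow_of_exponent_le (by norm_num : (1 : ℝ) ≤ 8)
          (by linarith : alph g ≤ 1)
      have h2 : (G / 2) ^ (-alph g) * ((n : ℝ) / 4) ^ (-alph g)
          = 8 ^ alph g * (G ^ (-alph g) * (n : ℝ) ^ (-alph g)) := by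
        rw [div_rpow hG0.le (by norm_num), div_rpow hn0.le (by norm_num),
          rpow_neg (by norm_num : (0 : ℝ) ≤ 2), rpow_neg (by norm_num : (0 : ℝ) ≤ 4),
          show (8 : ℝ) = 2 * 4 by norm_num, mul_rpow (by norm_num) (by norm_num)]
        field_simp
      calc _ = lam⁻¹ ^ 2 * G * ((G / 2) ^ (-alph g) * ((n : ℝ) / 4) ^ (-alph g)) := by ring
        _ = 8 ^ alph g * (lam⁻¹ ^ 2 * (G * G ^ (-alph g)) * (n : ℝ) ^ (-alph g)) := by
          rw [h2]; ring
        _ ≤ 8 * (lam⁻¹ ^ 2 * (G * G ^ (-alph g)) * (n : ℝ) ^ (-alph g)) := by gcongr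
        _ = 8 * lam ^ (2 * g + 3) * Real.log n
              * ((n : ℝ) ^ (2 * alph g - 1) * (n : ℝ) ^ (-alph g)) := by
          rw [hGpow]; field_simp; ring
        _ ≤ (n : ℝ) ^ (1 - alph g - 1 / 3)
              * ((n : ℝ) ^ (2 * alph g - 1) * (n : ℝ) ^ (-alph g)) := by gcongr
        _ = (n : ℝ) ^ (-(1 / 3) : ℝ) := by
          rw [← rpow_add hn0, ← rpow_add hn0]; congr 1; ring
    have h := measureReal_ncard_Rn_lt_le hM hlam0 (by omega) h01 h02 h12 hsum hA hind (hPr n)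
      hG hGM hGn hK₁ hK₂ hK₃ ?_ ?_ ?_ hq
    · rwa [e₃] at h
    · have h1 : 1 ≤ lam ^ (2 * g + 4) := one_le_pow₀ hlam1
      have h2 : 32 * M * Real.log n ≤
          lam ^ (2 * g + 4) * (n : ℝ) ^ (2 * alph g - 1) * Real.log n := by
        calc _ ≤ 1 * (n : ℝ) ^ (2 * alph g - 1) * Real.log n := by rw [one_mul]; gcongr
          _ ≤ _ := by gcongr
      rw [e₁, div_div, le_div_iff₀ (by positivity)]
      linarith
    · rw [e₂, div_div, le_div_iff₀ (by positivity)]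
      linarith
    · have h1 : lam ≤ lam ^ (2 * g + 2) := le_self_pow₀ hlam1 (by omega)
      rw [e₃]
      refine mul_le_mul_of_nonneg_right ?_ hlog.le
      rw [inv_mul_eq_div, le_div_iff₀ (by positivity)]
      linarith
  have hsummable : Summable fun n : ℕ => 5 * ((n : ℝ) ^ 2)⁻¹ :=
    (Real.summable_nat_pow_inv.2 (by norm_num)).mul_left 5
  filter_upwards [ae_eventually_notMem_of_measureReal_le hsummable hfail] with ω hω
  obtain ⟨N, hN⟩ := Filter.eventually_atTop.1 hω
  exact ⟨N, fun n hn => not_lt.1 (hN n hn)⟩
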